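/- arXiv:2305.06256 — 2 statements merged into one kernel-verified Lean document; each statement's English description precedes it below -/
import Mathlib

section
/- Assume each utility u_i is continuous, strictly increasing, quasiconcave, and differentiable on the interior of ℝ_{≥0}^K. Then a vector u ∈ ℝ^N is a maximal element of the utility possibility set UPS if and only if it is a minimal element of the indirect utility possibility set VPS. -/
/-- Euclidean inner product on `ℝ^K`. -/
noncomputable def dot {K : ℕ} (p x : Fin K → ℝ) : ℝ := ∑ k, p k * x k

/-- Membership in the nonnegative orthant `ℝ_{≥0}^K`. -/
def nonneg {K : ℕ} (x : Fin K → ℝ) : Prop := ∀ k, 0 ≤ x k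

/-- Strictly positive price vector. -/
def posVec {K : ℕ} (p : Fin K → ℝ) : Prop := ∀ k, 0 < p k

/-- `v` is the indirect utility of `u`: for every strictly positive price `p` and income
`m ≥ 0`, `v p m` is the maximum of `u` over the budget set
`{x ∈ ℝ_{≥0}^K : ⟨p,x⟩ ≤ m}`. -/
def IsIndirectUtility {K : ℕ} (u : (Fin K → ℝ) → ℝ) (v : (Fin K → ℝ) → ℝ → ℝ) : Prop :=
  ∀ p m, posVec p → 0 ≤ m →
    IsGreatest {t | ∃ x, nonneg x ∧ dot p x ≤ m ∧ u x = t} (v p m)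

/-- The set of feasible allocations `F(w)`. -/
def Feasible {K N : ℕ} (w : Fin K → ℝ) (x : Fin N → Fin K → ℝ) : Prop :=
  (∀ i, nonneg (x i)) ∧ ∀ k, (∑ i, x i k) ≤ w k

/-- Normalized strictly positive prices `Σ_K^+(w)`. -/
def PriceSimplex {K : ℕ} (w p : Fin K → ℝ) : Prop := posVec p ∧ dot p w = 1

/-- Income distributions `Σ_N`. -/
def IncomeSimplex {N : ℕ} (m : Fin N → ℝ) : Prop := (∀ i, 0 ≤ m i) ∧ (∑ i, m i) = 1

/-- The utility possibility set. -/
def UPS {K N : ℕ} (w : Fin K → ℝ) (u : Fin N → (Fin K → ℝ) → ℝ) : Set (Fin N → ℝ) :=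
  {e | ∃ x, Feasible w x ∧ ∀ i, e i = u i (x i)}

/-- The indirect utility possibility set. -/
def VPS {K N : ℕ} (w : Fin K → ℝ) (v : Fin N → (Fin K → ℝ) → ℝ → ℝ) : Set (Fin N → ℝ) :=
  {e | ∃ p m, PriceSimplex w p ∧ IncomeSimplex m ∧ ∀ i, e i = v i p (m i)}

/-- A Walrasian equilibrium with income distribution `m`. -/
def WalrasEq {K N : ℕ} (w : Fin K → ℝ) (u : Fin N → (Fin K → ℝ) → ℝ)
    (v : Fin N → (Fin K → ℝ) → ℝ → ℝ)
    (x : Fin N → Fin K → ℝ) (p : Fin K → ℝ) (m : Fin N → ℝ) : Prop :=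
  Feasible w x ∧ PriceSimplex w p ∧ ∀ i, dot p (x i) = m i ∧ u i (x i) = v i p (m i)

/-- Pareto optimality of an allocation `x ∈ F(w)`. -/
def ParetoOptimal {K N : ℕ} (w : Fin K → ℝ) (u : Fin N → (Fin K → ℝ) → ℝ)
    (x : Fin N → Fin K → ℝ) : Prop :=
  Feasible w x ∧
    ¬ ∃ x', Feasible w x' ∧ (∀ i, u i (x i) ≤ u i (x' i)) ∧ ∃ j, u j (x j) < u j (x' j)

open scoped Pointwise in
/-- A finite Minkowski sum of closed subsets of the nonnegative orthant is closed. -/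
theorem isClosed_sum_of_nonneg {K N : ℕ} {C : Fin N → Set (Fin K → ℝ)}
    (hC : ∀ i, IsClosed (C i)) (hpos : ∀ i, ∀ x ∈ C i, nonneg x) :
    IsClosed (∑ i, C i) := by
  refine IsSeqClosed.isClosed fun a b ha hab => ?_
  simp only [Set.mem_fintype_sum, exists_prop] at ha ⊢
  choose y hy hya using ha
  obtain ⟨M, hM⟩ := (Metric.isBounded_range_of_tendsto a hab).bddAbove
  have hbox : ∀ n, y n ∈ Set.Icc (0 : Fin N → Fin K → ℝ) (fun _ => M) := fun n => by
    refine ⟨fun i k => hpos i _ (hy n i) k, fun i k => ?_⟩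
    have h1 : y n i k ≤ ∑ j, y n j k :=
      Finset.single_le_sum (f := fun j => y n j k) (fun j _ => hpos j _ (hy n j) k)
        (Finset.mem_univ i)
    have h2 : a n k ≤ M k := hM ⟨n, rfl⟩ k
    rw [← hya n, Finset.sum_apply] at h2
    exact h1.trans h2
  obtain ⟨z, -, φ, hφ, hz⟩ := isCompact_Icc.tendsto_subseq hbox
  have hzi : ∀ i, Filter.Tendsto (fun n => y (φ n) i) Filter.atTop (nhds (z i)) :=
    fun i => (tendsto_pi_nhds.1 hz) i
  refine ⟨z, fun i => (hC i).mem_of_tendsto (hzi i) (.of_forall fun n => hy (φ n) i), ?_⟩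
  refine tendsto_nhds_unique (tendsto_finsetSum _ fun i _ => hzi i) ?_
  simpa only [hya, Function.comp_def] using hab.comp hφ.tendsto_atTop

theorem dot_add {K : ℕ} (p x y : Fin K → ℝ) : dot p (x + y) = dot p x + dot p y :=
  dotProduct_add p x y

theorem dot_smul {K : ℕ} (p x : Fin K → ℝ) (c : ℝ) : dot p (c • x) = c * dot p x :=
  dotProduct_smul c p x

theorem add_dot {K : ℕ} (p q x : Fin K → ℝ) : dot (p + q) x = dot p x + dot q x :=
  add_dotProduct p q x

theorem smul_dot {K : ℕ} (p x : Fin K → ℝ) (c : ℝ) : dot (c • p) x = c * dot p x :=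
  smul_dotProduct c p x

theorem dot_single_one {K : ℕ} (p : Fin K → ℝ) (k : Fin K) : dot p (Pi.single k 1) = p k :=
  dotProduct_single_one p k

theorem nonneg_single_one {K : ℕ} (k : Fin K) : nonneg (Pi.single k 1 : Fin K → ℝ) := fun j => by
  by_cases h : j = k
  · subst h
    simp
  · simp [h]

theorem dot_zero {K : ℕ} (p : Fin K → ℝ) : dot p 0 = 0 :=
  dotProduct_zero p

theorem dot_sum {K N : ℕ} (p : Fin K → ℝ) (x : Fin N → Fin K → ℝ) :
    dot p (∑ i, x i) = ∑ i, dot p (x i) :=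
  dotProduct_sum p Finset.univ x

theorem dot_nonneg {K : ℕ} {p x : Fin K → ℝ} (hp : nonneg p) (hx : nonneg x) : 0 ≤ dot p x :=
  Finset.sum_nonneg fun k _ => mul_nonneg (hp k) (hx k)

theorem dot_mono {K : ℕ} {p x y : Fin K → ℝ} (hp : nonneg p) (h : ∀ k, x k ≤ y k) :
    dot p x ≤ dot p y :=
  Finset.sum_le_sum fun k _ => mul_le_mul_of_nonneg_left (h k) (hp k)

theorem posVec.nonneg {K : ℕ} {p : Fin K → ℝ} (hp : posVec p) : nonneg p := fun k => (hp k).le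

theorem dot_pos {K : ℕ} (hK : 1 ≤ K) {p x : Fin K → ℝ} (hp : posVec p) (hx : posVec x) :
    0 < dot p x :=
  Finset.sum_pos (fun k _ => mul_pos (hp k) (hx k)) ⟨⟨0, hK⟩, Finset.mem_univ _⟩

theorem eq_zero_of_dot_nonpos {K : ℕ} {p x : Fin K → ℝ} (hp : posVec p) (hx : nonneg x)
    (h : dot p x ≤ 0) : x = 0 := by
  funext k
  have h1 : p k * x k ≤ dot p x :=
    Finset.single_le_sum (f := fun k => p k * x k)
      (fun j _ => mul_nonneg (hp j).le (hx j)) (Finset.mem_univ k)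
  exact le_antisymm (nonpos_of_mul_nonpos_right (h1.trans h) (hp k)) (hx k)

/-- Every linear functional on `ℝ^K` is given by a price vector. -/
theorem exists_dot_eq {K : ℕ} (f : StrongDual ℝ (Fin K → ℝ)) : ∃ p, ∀ x, f x = dot p x := by
  refine ⟨fun k => f (Pi.single k 1), fun x => ?_⟩
  conv_lhs => rw [pi_eq_sum_univ' x]
  simp [dot, mul_comm, map_sum, Pi.single]

/-- A functional bounded below on a set stable under adding nonnegative vectors has
nonnegative coefficients. -/
theorem nonneg_of_forall_lt_dot {K : ℕ} {p a : Fin K → ℝ} {c : ℝ}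
    (h : ∀ z, nonneg z → c < dot p (a + z)) : nonneg p := by
  intro k
  by_contra! hk
  have hca : c < dot p a := by simpa using h 0 fun _ => le_rfl
  have ht : 0 ≤ (dot p a - c) / (-p k) := div_nonneg (by linarith) (by linarith)
  have := h (((dot p a - c) / (-p k)) • Pi.single k 1) fun j =>
    mul_nonneg ht (nonneg_single_one k j)
  rw [dot_add, dot_smul, dot_single_one] at this
  have h2 : (dot p a - c) / (-p k) * p k = -(dot p a - c) := by
    have := hk.ne
    field_simp
  linarith

/-- Strict utility comparisons survive a slight proportional reduction of the bundle. -/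
theorem exists_lt_smul {K : ℕ} {u : (Fin K → ℝ) → ℝ} (hu : ContinuousOn u {x | nonneg x})
    {y : Fin K → ℝ} (hy : nonneg y) {c : ℝ} (hc : c < u y) :
    ∃ s : ℝ, 0 < s ∧ s < 1 ∧ c < u (s • y) := by
  have hmap : Filter.Tendsto (fun s : ℝ => s • y) (nhdsWithin 1 (Set.Ioo 0 1))
      (nhdsWithin y {x | nonneg x}) := by
    refine tendsto_nhdsWithin_iff.2 ⟨?_, ?_⟩
    · have : Filter.Tendsto (fun s : ℝ => s • y) (nhds 1) (nhds ((1 : ℝ) • y)) :=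
        Continuous.tendsto (by fun_prop) 1
      rw [one_smul] at this
      exact this.mono_left nhdsWithin_le_nhds
    · filter_upwards [self_mem_nhdsWithin] with s hs k
      exact mul_nonneg hs.1.le (hy k)
  have hne : (nhdsWithin (1 : ℝ) (Set.Ioo 0 1)).NeBot := by
    rw [nhdsWithin_Ioo_eq_nhdsLT zero_lt_one]
    infer_instance
  obtain ⟨s, hs, hs'⟩ :=
    ((((hu y hy).tendsto.comp hmap).eventually_const_lt hc).and self_mem_nhdsWithin).exists
  exact ⟨s, hs'.1, hs'.2, hs⟩

/-- A bundle at least as good as the optimal one exhausts the income. -/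
theorem IsIndirectUtility.le_dot {K : ℕ} (hK : 1 ≤ K) {u : (Fin K → ℝ) → ℝ}
    {v : (Fin K → ℝ) → ℝ → ℝ} (hv : IsIndirectUtility u v)
    (hu : ∀ x y, nonneg x → nonneg y → (∀ k, x k ≤ y k) → x ≠ y → u x < u y)
    {p y : Fin K → ℝ} {m : ℝ} (hp : posVec p) (hm : 0 ≤ m) (hy : nonneg y)
    (h : v p m ≤ u y) : m ≤ dot p y := by
  by_contra! hlt
  have h1 : 0 < dot p 1 := dot_pos hK hp fun _ => zero_lt_one
  set δ := (m - dot p y) / dot p 1 with hδ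
  have hδ0 : 0 < δ := div_pos (by linarith) h1
  have hz : nonneg (y + δ • (1 : Fin K → ℝ)) := fun k => by
    have := hy k
    simp only [Pi.add_apply, Pi.smul_apply, Pi.one_apply, smul_eq_mul, mul_one]
    linarith
  have hle : u (y + δ • 1) ≤ v p m := by
    refine (hv p m hp hm).2 ⟨_, hz, ?_, rfl⟩
    rw [dot_add, dot_smul, hδ, div_mul_cancel₀ _ h1.ne']
    linarith
  have hlt' : u y < u (y + δ • 1) := by
    refine hu _ _ hy hz (fun k => ?_) fun heq => ?_
    · simp only [Pi.add_apply, Pi.smul_apply, Pi.one_apply, smul_eq_mul, mul_one]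
      linarith
    · have := congrFun heq ⟨0, hK⟩
      simp only [Pi.add_apply, Pi.smul_apply, Pi.one_apply, smul_eq_mul, mul_one] at this
      linarith
  linarith

theorem Feasible.sum_dot_le {K N : ℕ} {w : Fin K → ℝ} {x : Fin N → Fin K → ℝ}
    (hx : Feasible w x) {p : Fin K → ℝ} (hp : nonneg p) : ∑ i, dot p (x i) ≤ dot p w := by
  rw [← dot_sum]
  exact dot_mono hp fun k => by simpa using hx.2 k

/-- A feasible utility vector that weakly dominates an indirect utility vector equals it. -/
theorem Feasible.indirect_eq {K N : ℕ} (hK : 1 ≤ K) {w : Fin K → ℝ}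
    {u : Fin N → (Fin K → ℝ) → ℝ} {v : Fin N → (Fin K → ℝ) → ℝ → ℝ}
    (hu : ∀ i x y, nonneg x → nonneg y → (∀ k, x k ≤ y k) → x ≠ y → u i x < u i y)
    (hv : ∀ i, IsIndirectUtility (u i) (v i))
    {x : Fin N → Fin K → ℝ} (hx : Feasible w x) {p : Fin K → ℝ} {m : Fin N → ℝ}
    (hp : PriceSimplex w p) (hm : IncomeSimplex m) (h : ∀ i, v i p (m i) ≤ u i (x i)) (i : Fin N) :
    v i p (m i) = u i (x i) := by
  have hle : ∀ i ∈ Finset.univ, m i ≤ dot p (x i) := fun i _ =>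
    (hv i).le_dot hK (hu i) hp.1 (hm.1 i) (hx.1 i) (h i)
  have hsum : ∑ i, m i = ∑ i, dot p (x i) := by
    refine le_antisymm (Finset.sum_le_sum hle) ?_
    rw [hm.2, ← hp.2]
    exact hx.sum_dot_le hp.1.nonneg
  have heq := (Finset.sum_eq_sum_iff_of_le hle).1 hsum i (Finset.mem_univ i)
  exact le_antisymm (h i) ((hv i p _ hp.1 (hm.1 i)).2 ⟨x i, hx.1 i, heq.ge, rfl⟩)

/-- Giving an additional nonnegative bundle to one consumer hurts nobody, and strictly benefits
that consumer when the bundle is nonzero. -/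
theorem exists_redistribution {K N : ℕ} {u : Fin N → (Fin K → ℝ) → ℝ}
    (hu : ∀ i x y, nonneg x → nonneg y → (∀ k, x k ≤ y k) → x ≠ y → u i x < u i y)
    (i₀ : Fin N) {y : Fin N → Fin K → ℝ} (hy : ∀ i, nonneg (y i)) {z : Fin K → ℝ}
    (hz : nonneg z) :
    ∃ y' : Fin N → Fin K → ℝ, (∀ i, nonneg (y' i)) ∧ ∑ i, y' i = ∑ i, y i + z ∧
      (∀ i, u i (y i) ≤ u i (y' i)) ∧ (z ≠ 0 → u i₀ (y i₀) < u i₀ (y' i₀)) := by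
  have hle : ∀ i k, y i k ≤ (y i + (if i = i₀ then z else 0)) k := fun i k => by
    split_ifs
    · exact le_add_of_nonneg_right (hz k)
    · simp
  have hnn : ∀ i, nonneg (y i + (if i = i₀ then z else 0)) := fun i k => (hy i k).trans (hle i k)
  refine ⟨fun i => y i + (if i = i₀ then z else 0), hnn, ?_, fun i => ?_, fun hz0 => ?_⟩
  · simp [Finset.sum_add_distrib]
  · by_cases h : y i = y i + (if i = i₀ then z else 0)
    · exact le_of_eq (congrArg _ h)
    · exact (hu i _ _ (hy i) (hnn i) (hle i) h).le
  · exact hu i₀ _ _ (hy i₀) (hnn i₀) (hle i₀) (by simpa using hz0)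

open scoped Pointwise in
/-- A maximal utility vector is supported by a nonzero nonnegative price vector. -/
theorem exists_supporting_price {K N : ℕ} (hK : 1 ≤ K) (hN : 1 ≤ N) {w : Fin K → ℝ}
    (hw : posVec w) {u : Fin N → (Fin K → ℝ) → ℝ}
    (hu : ∀ i x y, nonneg x → nonneg y → (∀ k, x k ≤ y k) → x ≠ y → u i x < u i y)
    (hu_qc : ∀ i (c : ℝ), Convex ℝ {x | nonneg x ∧ c ≤ u i x})
    {x : Fin N → Fin K → ℝ} (hx : ∀ i, nonneg (x i))
    (hmax : ∀ e' ∈ UPS w u, (∀ i, u i (x i) ≤ e' i) → e' = fun i => u i (x i)) :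
    ∃ p, nonneg p ∧ 0 < dot p w ∧ ∀ y : Fin N → Fin K → ℝ, (∀ i, nonneg (y i)) →
      (∀ i, u i (x i) ≤ u i (y i)) → dot p w ≤ ∑ i, dot p (y i) := by
  set T : Set (Fin K → ℝ) := ∑ i, {z | nonneg z ∧ u i (x i) ≤ u i z}
  set P : Set (Fin K → ℝ) := {z | posVec z} with hP
  have hmem : ∀ y : Fin N → Fin K → ℝ, (∀ i, nonneg (y i)) → (∀ i, u i (x i) ≤ u i (y i)) →
      ∑ i, y i ∈ T := fun y hy hy' =>
    (Set.mem_fintype_sum _ _).2 ⟨y, fun i => ⟨hy i, hy' i⟩, rfl⟩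
  have hTconv : Convex ℝ T := convex_sum _ fun i _ => hu_qc i _
  have hPset : P = Set.pi Set.univ fun _ => Set.Ioi 0 := by
    ext z
    simp [hP, posVec]
  have hPconv : Convex ℝ P := hPset ▸ convex_pi fun _ _ => convex_Ioi 0
  have hPopen : IsOpen P := hPset ▸ isOpen_set_pi Set.finite_univ fun _ _ => isOpen_Ioi
  have hwT : w ∉ T + P := by
    rintro ⟨a, ha, z, hz, rfl⟩
    obtain ⟨y, hy, rfl⟩ := (Set.mem_fintype_sum _ _).1 ha
    obtain ⟨y', hy', hsum, hle, hlt⟩ :=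
      exists_redistribution hu ⟨0, hN⟩ (fun i => (hy i).1) (posVec.nonneg hz)
    have heq := congrFun (hmax (fun i => u i (y' i))
      ⟨y', ⟨hy', fun k => by rw [← Finset.sum_apply, hsum]⟩, fun i => rfl⟩
      fun i => (hy i).2.trans (hle i)) ⟨0, hN⟩
    have hz0 : z ≠ 0 := fun h => (hz ⟨0, hK⟩).ne' (congrFun h _)
    exact ((hy _).2.trans_lt (hlt hz0)).ne' heq
  obtain ⟨f, hf⟩ := geometric_hahn_banach_point_open (hTconv.add hPconv) hPopen.add_left hwT
  obtain ⟨p, hp⟩ := exists_dot_eq f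
  simp only [hp] at hf
  have hone : posVec (1 : Fin K → ℝ) := fun _ => zero_lt_one
  have hp0 : nonneg p := by
    refine nonneg_of_forall_lt_dot (a := ∑ i, x i + 1) (c := dot p w) fun z hz => ?_
    rw [add_assoc]
    exact hf _ (Set.add_mem_add (hmem x hx fun i => le_rfl) fun k =>
      add_pos_of_pos_of_nonneg zero_lt_one (hz k))
  refine ⟨p, hp0, ?_, fun y hy hy' => ?_⟩
  · refine (dot_nonneg hp0 hw.nonneg).lt_of_ne fun h0 => ?_
    have hpz : p = 0 := by
      funext k
      have hk : p k * w k = 0 := (Finset.sum_eq_zero_iff_of_nonneg fun k _ =>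
        mul_nonneg (hp0 k) (hw k).le).1 h0.symm k (Finset.mem_univ k)
      exact (mul_eq_zero.1 hk).resolve_right (hw k).ne'
    have := hf _ (Set.add_mem_add (hmem x hx fun i => le_rfl) hone)
    simp [hpz, dot] at this
  · rw [← dot_sum]
    refine le_of_forall_pos_lt_add fun ε hε => ?_
    have hd : 0 ≤ dot p 1 := dot_nonneg hp0 hone.nonneg
    have := hf _ (Set.add_mem_add (hmem y hy hy')
      (show (ε / (dot p 1 + 1)) • (1 : Fin K → ℝ) ∈ P from fun k => by
        simpa using div_pos hε (by linarith)))
    rw [dot_add, dot_smul] at this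
    have h2 : ε / (dot p 1 + 1) * dot p 1 ≤ ε := by
      rw [div_mul_eq_mul_div, div_le_iff₀ (by linarith)]
      nlinarith
    linarith

/-- Maximal elements of the utility possibility set are indirect utility vectors. -/
theorem mem_VPS_of_maximal_UPS {K N : ℕ} (hK : 1 ≤ K) (hN : 1 ≤ N) {w : Fin K → ℝ}
    (hw : posVec w) {u : Fin N → (Fin K → ℝ) → ℝ}
    (hu_cont : ∀ i, ContinuousOn (u i) {x | nonneg x})
    (hu : ∀ i x y, nonneg x → nonneg y → (∀ k, x k ≤ y k) → x ≠ y → u i x < u i y)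
    (hu_qc : ∀ i (c : ℝ), Convex ℝ {x | nonneg x ∧ c ≤ u i x})
    {v : Fin N → (Fin K → ℝ) → ℝ → ℝ} (hv : ∀ i, IsIndirectUtility (u i) (v i))
    {x : Fin N → Fin K → ℝ} (hx : Feasible w x)
    (hmax : ∀ e' ∈ UPS w u, (∀ i, u i (x i) ≤ e' i) → e' = fun i => u i (x i)) :
    (fun i => u i (x i)) ∈ VPS w v := by
  obtain ⟨p, hp0, hpw, hp⟩ := exists_supporting_price hK hN hw hu hu_qc hx.1 hmax
  have hsum : ∑ i, dot p (x i) = dot p w :=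
    le_antisymm (hx.sum_dot_le hp0) (hp x hx.1 fun i => le_rfl)
  have hcost : ∀ i y, nonneg y → u i (x i) ≤ u i y → dot p (x i) ≤ dot p y := by
    intro i y hy hle
    have := hp (Function.update x i y)
      (fun j => by
        rcases eq_or_ne j i with rfl | h
        · simpa using hy
        · simpa [h] using hx.1 j)
      (fun j => by
        rcases eq_or_ne j i with rfl | h
        · simpa using hle
        · simp [h])
    rw [← hsum, ← Finset.add_sum_erase _ _ (Finset.mem_univ i),
      ← Finset.add_sum_erase _ (fun j => dot p (Function.update x i y j)) (Finset.mem_univ i)] at this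
    have herase : ∑ j ∈ Finset.univ.erase i, dot p (Function.update x i y j) =
        ∑ j ∈ Finset.univ.erase i, dot p (x j) :=
      Finset.sum_congr rfl fun j hj => by rw [Function.update_of_ne (Finset.ne_of_mem_erase hj)]
    rw [herase, Function.update_self] at this
    linarith
  -- strictly better bundles of positive cost are strictly more expensive
  have hstrict : ∀ i y, nonneg y → u i (x i) < u i y → 0 < dot p y → dot p (x i) < dot p y := by
    intro i y hy hlt hpos
    obtain ⟨s, hs0, hs1, hs⟩ := exists_lt_smul (hu_cont i) hy hlt
    have := hcost i (s • y) (fun k => mul_nonneg hs0.le (hy k)) hs.le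
    rw [dot_smul] at this
    nlinarith
  have hppos : posVec p := by
    intro k
    refine (hp0 k).lt_of_ne fun hk => ?_
    obtain ⟨i, hi⟩ : ∃ i, 0 < dot p (x i) := by
      by_contra! h
      exact hpw.not_ge (hsum ▸ Finset.sum_nonpos fun i _ => h i)
    have hek : nonneg (Pi.single k 1 : Fin K → ℝ) := nonneg_single_one k
    have hnn : nonneg (x i + Pi.single k 1) := fun j => add_nonneg (hx.1 i j) (hek j)
    have hd : dot p (x i + Pi.single k 1) = dot p (x i) := by
      rw [dot_add, dot_single_one, ← hk, add_zero]
    have := hstrict i _ hnn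
      (hu i _ _ (hx.1 i) hnn (fun j => le_add_of_nonneg_right (hek j)) fun heq => by
        have := congrFun heq k
        simp at this) (hd ▸ hi)
    exact this.ne hd.symm
  have hc : 0 < (dot p w)⁻¹ := inv_pos.2 hpw
  have hqpos : posVec ((dot p w)⁻¹ • p) := fun k => mul_pos hc (hppos k)
  refine ⟨(dot p w)⁻¹ • p, fun i => (dot p w)⁻¹ * dot p (x i), ⟨hqpos, ?_⟩,
    ⟨fun i => mul_nonneg hc.le (dot_nonneg hp0 (hx.1 i)), ?_⟩, fun i => ?_⟩
  · rw [smul_dot, inv_mul_cancel₀ hpw.ne']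
  · rw [← Finset.mul_sum, hsum, inv_mul_cancel₀ hpw.ne']
  · obtain ⟨⟨y, hy, hyb, hyv⟩, hub⟩ := hv i ((dot p w)⁻¹ • p) ((dot p w)⁻¹ * dot p (x i)) hqpos
      (mul_nonneg hc.le (dot_nonneg hp0 (hx.1 i)))
    refine le_antisymm (hub ⟨x i, hx.1 i, (smul_dot _ _ _).le, rfl⟩) ?_
    rw [← hyv]
    by_contra! hlt
    rw [smul_dot, mul_le_mul_iff_right₀ hc] at hyb
    refine (hstrict i y hy hlt ?_).not_ge hyb
    by_contra! hneg
    obtain rfl := eq_zero_of_dot_nonpos hppos hy hneg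
    by_cases h0 : 0 = x i
    · rw [← h0] at hlt
      exact lt_irrefl _ hlt
    · exact hlt.not_gt (hu i _ _ hy (hx.1 i) (hx.1 i) h0)

open scoped Pointwise in
/-- An infeasible indirect utility vector leaves room for prices at which the expenditure
needed to attain it is bounded away from the value of the endowment. -/
theorem exists_separating_price {K N : ℕ} (hK : 1 ≤ K) (hN : 1 ≤ N) {w : Fin K → ℝ}
    (hw : posVec w) {u : Fin N → (Fin K → ℝ) → ℝ}
    (hu_cont : ∀ i, ContinuousOn (u i) {x | nonneg x})
    (hu : ∀ i x y, nonneg x → nonneg y → (∀ k, x k ≤ y k) → x ≠ y → u i x < u i y)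
    (hu_qc : ∀ i (c : ℝ), Convex ℝ {x | nonneg x ∧ c ≤ u i x})
    {v : Fin N → (Fin K → ℝ) → ℝ → ℝ} (hv : ∀ i, IsIndirectUtility (u i) (v i))
    {p : Fin K → ℝ} {m : Fin N → ℝ} (hp : PriceSimplex w p) (hm : IncomeSimplex m)
    (hnot : (fun i => v i p (m i)) ∉ UPS w u) :
    ∃ q c, PriceSimplex w q ∧ 1 < c ∧ ∀ y : Fin N → Fin K → ℝ, (∀ i, nonneg (y i)) →
      (∀ i, v i p (m i) ≤ u i (y i)) → c ≤ ∑ i, dot q (y i) := by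
  set T : Set (Fin K → ℝ) := ∑ i, {z | nonneg z ∧ v i p (m i) ≤ u i z}
  have hmem : ∀ y : Fin N → Fin K → ℝ, (∀ i, nonneg (y i)) →
      (∀ i, v i p (m i) ≤ u i (y i)) → ∑ i, y i ∈ T := fun y hy hy' =>
    (Set.mem_fintype_sum _ _).2 ⟨y, fun i => ⟨hy i, hy' i⟩, rfl⟩
  have hTconv : Convex ℝ T := convex_sum _ fun i _ => hu_qc i _
  have horth : IsClosed {x : Fin K → ℝ | nonneg x} := by
    simp only [nonneg, Set.ofPred_forall]
    exact isClosed_iInter fun k => isClosed_le continuous_const (continuous_apply k)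
  have hTclosed : IsClosed T := isClosed_sum_of_nonneg
    (fun i => (hu_cont i).preimage_isClosed_of_isClosed horth isClosed_Ici) fun i x hx => hx.1
  have hwT : w ∉ T := fun hwT => by
    obtain ⟨y, hy, hyw⟩ := (Set.mem_fintype_sum _ _).1 hwT
    have hyF : Feasible w y := ⟨fun i => (hy i).1, fun k => by simp [← hyw]⟩
    exact hnot ⟨y, hyF, hyF.indirect_eq hK hu hv hp hm fun i => (hy i).2⟩
  obtain ⟨f, s, hfw, hfT⟩ := geometric_hahn_banach_point_closed hTconv hTclosed hwT
  obtain ⟨r, hr⟩ := exists_dot_eq f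
  simp only [hr] at hfw hfT
  choose x hx hxb hxv using fun i => (hv i p (m i) hp.1 (hm.1 i)).1
  have hr0 : nonneg r := by
    refine nonneg_of_forall_lt_dot (a := ∑ i, x i) (c := s) fun z hz => hfT _ ?_
    obtain ⟨y, hy, hsum, hle, -⟩ := exists_redistribution hu ⟨0, hN⟩ hx hz
    exact hsum ▸ hmem y hy fun i => hxv i ▸ hle i
  have hqpos : posVec (r + p) := fun k => add_pos_of_nonneg_of_pos (hr0 k) (hp.1 k)
  have hD : 0 < dot (r + p) w := dot_pos hK hqpos hw
  have hDlt : dot (r + p) w < s + 1 := by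
    rw [add_dot, hp.2]
    linarith
  refine ⟨(dot (r + p) w)⁻¹ • (r + p), (dot (r + p) w)⁻¹ * (s + 1),
    ⟨fun k => mul_pos (inv_pos.2 hD) (hqpos k), ?_⟩, ?_, fun y hy hyv => ?_⟩
  · rw [smul_dot, inv_mul_cancel₀ hD.ne']
  · rwa [inv_mul_eq_div, one_lt_div hD]
  · rw [← dot_sum, smul_dot]
    refine mul_le_mul_of_nonneg_left ?_ (inv_pos.2 hD).le
    have h1 : 1 ≤ dot p (∑ i, y i) := by
      rw [dot_sum, ← hm.2]
      exact Finset.sum_le_sum fun i _ => (hv i).le_dot hK (hu i) hp.1 (hm.1 i) (hy i) (hyv i)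
    rw [add_dot]
    exact add_le_add (hfT _ (hmem y hy hyv)).le h1

/-- Minimal elements of the indirect utility possibility set are feasible. -/
theorem mem_UPS_of_minimal_VPS {K N : ℕ} (hK : 1 ≤ K) (hN : 1 ≤ N) {w : Fin K → ℝ}
    (hw : posVec w) {u : Fin N → (Fin K → ℝ) → ℝ}
    (hu_cont : ∀ i, ContinuousOn (u i) {x | nonneg x})
    (hu : ∀ i x y, nonneg x → nonneg y → (∀ k, x k ≤ y k) → x ≠ y → u i x < u i y)
    (hu_qc : ∀ i (c : ℝ), Convex ℝ {x | nonneg x ∧ c ≤ u i x})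
    {v : Fin N → (Fin K → ℝ) → ℝ → ℝ} (hv : ∀ i, IsIndirectUtility (u i) (v i))
    {p : Fin K → ℝ} {m : Fin N → ℝ} (hp : PriceSimplex w p) (hm : IncomeSimplex m)
    (hmin : ∀ e' ∈ VPS w v, (∀ i, e' i ≤ v i p (m i)) → e' = fun i => v i p (m i)) :
    (fun i => v i p (m i)) ∈ UPS w u := by
  by_contra hnot
  obtain ⟨q, c, hq, hc, hqc⟩ :=
    exists_separating_price hK hN hw hu_cont hu hu_qc hv hp hm hnot
  set S : Fin N → Set ℝ := fun i => Set.image (dot q) {z | nonneg z ∧ v i p (m i) ≤ u i z}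
  have hSne : ∀ i, (S i).Nonempty := fun i => by
    obtain ⟨y, hy, -, hyv⟩ := (hv i p (m i) hp.1 (hm.1 i)).1
    exact ⟨_, y, ⟨hy, hyv.ge⟩, rfl⟩
  have hS0 : ∀ i, ∀ t ∈ S i, 0 ≤ t := by
    rintro i _ ⟨y, hy, rfl⟩
    exact dot_nonneg hq.1.nonneg hy.1
  have hSbdd : ∀ i, BddBelow (S i) := fun i => ⟨0, hS0 i⟩
  set E : Fin N → ℝ := fun i => sInf (S i)
  have hE0 : ∀ i, 0 ≤ E i := fun i => le_csInf (hSne i) (hS0 i)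
  have hNpos : (0 : ℝ) < N := by exact_mod_cast hN
  have hM : 1 < ∑ i, E i := by
    have hε : 0 < (c - 1) / N := div_pos (by linarith) hNpos
    have hex : ∀ i, ∃ y, (nonneg y ∧ v i p (m i) ≤ u i y) ∧ dot q y < E i + (c - 1) / N :=
      fun i => by
        obtain ⟨_, ⟨y, hy, rfl⟩, hlt⟩ :=
          exists_lt_of_csInf_lt (hSne i) (lt_add_of_pos_right (E i) hε)
        exact ⟨y, hy, hlt⟩
    choose y hy hyE using hex
    have h1 := hqc y (fun i => (hy i).1) fun i => (hy i).2
    have h2 : ∑ i, dot q (y i) < ∑ i, (E i + (c - 1) / N) :=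
      Finset.sum_lt_sum_of_nonempty ⟨⟨0, hN⟩, Finset.mem_univ _⟩ fun i _ => hyE i
    rw [Finset.sum_add_distrib, Finset.sum_const, Finset.card_univ, Fintype.card_fin,
      nsmul_eq_mul, mul_div_cancel₀ _ hNpos.ne'] at h2
    linarith
  have hM0 : 0 < ∑ i, E i := by linarith
  have hm' : IncomeSimplex fun i => E i / ∑ j, E j :=
    ⟨fun i => div_nonneg (hE0 i) hM0.le, by rw [← Finset.sum_div, div_self hM0.ne']⟩
  have hlt : ∀ i, 0 < E i → v i q (E i / ∑ j, E j) < v i p (m i) := fun i hi => by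
    obtain ⟨y, hy, hyb, hyv⟩ := (hv i q _ hq.1 (hm'.1 i)).1
    rw [← hyv]
    by_contra! hle
    exact notMem_of_lt_csInf (hyb.trans_lt (div_lt_self hi hM)) (hSbdd i) ⟨y, ⟨hy, hle⟩, rfl⟩
  have hle : ∀ i, v i q (E i / ∑ j, E j) ≤ v i p (m i) := fun i => by
    rcases (hE0 i).lt_or_eq with hi | hi
    · exact (hlt i hi).le
    · obtain ⟨y, hy, hyb, hyv⟩ := (hv i q _ hq.1 (hm'.1 i)).1
      simp only [← hi, zero_div] at hyb
      obtain rfl := eq_zero_of_dot_nonpos hq.1 hy hyb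
      rw [← hyv]
      exact (hv i p _ hp.1 (hm.1 i)).2 ⟨0, hy, (dot_zero p).trans_le (hm.1 i), rfl⟩
  have heq := hmin _ ⟨q, _, hq, hm', fun i => rfl⟩ hle
  obtain ⟨i, -, hi⟩ : ∃ i ∈ Finset.univ, 0 < E i := by
    by_contra! h
    exact hM0.not_ge (Finset.sum_nonpos h)
  exact (hlt i hi).ne (congrFun heq i)

/-- a vector is a maximal element of the UPS iff it is a minimal element of
the VPS. -/
theorem maximal_UPS_iff_minimal_VPS {K N : ℕ} (hK : 1 ≤ K) (hN : 1 ≤ N)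
    (w : Fin K → ℝ) (hw : posVec w)
    (u : Fin N → (Fin K → ℝ) → ℝ)
    (hu_cont : ∀ i, ContinuousOn (u i) {x | nonneg x})
    (hu_mono : ∀ i x y, nonneg x → nonneg y → (∀ k, x k ≤ y k) → x ≠ y → u i x < u i y)
    (hu_qc : ∀ i (c : ℝ), Convex ℝ {x | nonneg x ∧ c ≤ u i x})
    (hu_diff : ∀ i, DifferentiableOn ℝ (u i) {x | posVec x})
    (v : Fin N → (Fin K → ℝ) → ℝ → ℝ)
    (hv : ∀ i, IsIndirectUtility (u i) (v i)) :
    ∀ e : Fin N → ℝ,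
      (e ∈ UPS w u ∧ ∀ e' ∈ UPS w u, (∀ i, e i ≤ e' i) → e' = e) ↔
      (e ∈ VPS w v ∧ ∀ e' ∈ VPS w v, (∀ i, e' i ≤ e i) → e' = e) := by
  intro e
  constructor
  · rintro ⟨⟨x, hx, hex⟩, hmax⟩
    obtain rfl : e = fun i => u i (x i) := funext hex
    refine ⟨mem_VPS_of_maximal_UPS hK hN hw hu_cont hu_mono hu_qc hv hx hmax, ?_⟩
    rintro e' ⟨p, m, hp, hm, he'⟩ hle
    funext i
    rw [he' i]
    exact hx.indirect_eq hK hu_mono hv hp hm (fun i => he' i ▸ hle i) i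
  · rintro ⟨⟨p, m, hp, hm, hev⟩, hmin⟩
    obtain rfl : e = fun i => v i p (m i) := funext hev
    refine ⟨mem_UPS_of_minimal_VPS hK hN hw hu_cont hu_mono hu_qc hv hp hm hmin, ?_⟩
    rintro e' ⟨x, hx, he'⟩ hle
    funext i
    rw [he' i]
    exact (hx.indirect_eq hK hu_mono hv hp hm (fun i => he' i ▸ hle i) i).symm
end

section
/- (Dual Negishi first-order condition.) Assume each utility u_i is continuous, strictly increasing, quasiconcave, and differentiable on the interior of ℝ_{≥0}^K. Let (x,p) be a Walrasian equilibrium with income distribution m ∈ Σ_N where every m_i > 0, and assume each indirect utility v_i is differentiable at (p, m_i) with ∂v_i/∂m (p,m_i) > 0. Then markets clear, Σ_i x_i = w, and the price p satisfies the stationarity condition of the dual welfare minimization with welfare weights equal to inverse marginal utilities of income: setting α_i = (∂v_i/∂m (p,m_i))^{-1}, one has w + Σ_{i=1}^N α_i ∇_p v_i(p, m_i) = 0. -/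
theorem dot_smul_left {K : ℕ} (a : ℝ) (p x : Fin K → ℝ) : dot (a • p) x = a * dot p x := by
  simp [dot, Finset.mul_sum, mul_assoc]

/-- Indirect utility is homogeneous of degree zero. -/
theorem IsIndirectUtility.smul_mul {K : ℕ} {u : (Fin K → ℝ) → ℝ}
    {v : (Fin K → ℝ) → ℝ → ℝ} (hv : IsIndirectUtility u v) {p : Fin K → ℝ} {m a : ℝ}
    (hp : posVec p) (hm : 0 ≤ m) (ha : 0 < a) : v (a • p) (a * m) = v p m := by
  have h := hv (a • p) (a * m) (fun k => mul_pos ha (hp k)) (mul_nonneg ha.le hm)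
  simp only [dot_smul_left, mul_le_mul_iff_right₀ ha] at h
  exact h.unique (hv p m hp hm)

/-- Euler's identity for indirect utility. -/
theorem IsIndirectUtility.sum_mul_gradient {K : ℕ} {u : (Fin K → ℝ) → ℝ}
    {v : (Fin K → ℝ) → ℝ → ℝ} (hv : IsIndirectUtility u v) {p : Fin K → ℝ} {m : ℝ}
    (hp : posVec p) (hm : 0 < m) {gp : Fin K → ℝ} {gm : ℝ}
    (hgp : HasFDerivAt (fun q : Fin K → ℝ => v q m)
      (∑ k, gp k • (ContinuousLinearMap.proj k : (Fin K → ℝ) →L[ℝ] ℝ)) p)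
    (hgm : HasDerivAt (fun t : ℝ => v p t) gm m) :
    ∑ k, gp k * p k = -(m * gm) := by
  have hc : HasDerivAt (fun s : ℝ => s • p) p 1 := by
    simpa using (hasDerivAt_id (1 : ℝ)).smul_const p
  have hprice : HasDerivAt (fun s : ℝ => v (s • p) m) (∑ k, gp k * p k) 1 := by
    have h := HasFDerivAt.comp_hasDerivAt (f := fun s : ℝ => s • p) 1
      (by simpa only [one_smul] using hgp) hc
    simpa [Function.comp_def] using h
  have hi : HasDerivAt (fun s : ℝ => s⁻¹ * m) (-m) 1 := by
    simpa using (hasDerivAt_inv (one_ne_zero : (1 : ℝ) ≠ 0)).mul_const m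
  have hincome : HasDerivAt (fun s : ℝ => v p (s⁻¹ * m)) (gm * -m) 1 := by
    have h := HasDerivAt.comp (h := fun s : ℝ => s⁻¹ * m) 1 (by simpa using hgm) hi
    simpa [Function.comp_def] using h
  have heq : (fun s : ℝ => v (s • p) m) =ᶠ[nhds 1] fun s => v p (s⁻¹ * m) := by
    filter_upwards [lt_mem_nhds (zero_lt_one : (0 : ℝ) < 1)] with s hs
    have h := hv.smul_mul hp (mul_nonneg (inv_nonneg.2 hs.le) hm.le) hs
    rwa [mul_inv_cancel_left₀ hs.ne'] at h
  rw [hprice.unique (hincome.congr_of_eventuallyEq heq)]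
  ring

/-- Roy's identity. -/
theorem IsIndirectUtility.roy {K : ℕ} {u : (Fin K → ℝ) → ℝ}
    {v : (Fin K → ℝ) → ℝ → ℝ} (hv : IsIndirectUtility u v) {p x : Fin K → ℝ} {m : ℝ}
    (hp : posVec p) (hm : 0 < m) (hx : nonneg x) (hpx : dot p x = m) (hux : u x = v p m)
    {gp : Fin K → ℝ} {gm : ℝ}
    (hgp : HasFDerivAt (fun q : Fin K → ℝ => v q m)
      (∑ k, gp k • (ContinuousLinearMap.proj k : (Fin K → ℝ) →L[ℝ] ℝ)) p)
    (hgm : HasDerivAt (fun t : ℝ => v p t) gm m) (k : Fin K) :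
    gp k = -(gm * x k) := by
  have heuler := hv.sum_mul_gradient hp hm hgp hgm
  set e : Fin K → ℝ := Pi.single k 1 with he
  have hline : HasDerivAt (fun s : ℝ => p + s • e) e 0 := by
    simpa using ((hasDerivAt_id (0 : ℝ)).smul_const e).const_add p
  have hexp : HasDerivAt (fun s : ℝ => m + s * x k) (x k) 0 := by
    simpa using ((hasDerivAt_id (0 : ℝ)).mul_const (x k)).const_add m
  have hscale : HasDerivAt (fun s : ℝ => m * (m + s * x k)⁻¹) (-(x k / m)) 0 := by
    have h := (hexp.fun_inv (by simpa using hm.ne')).const_mul m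
    refine h.congr_deriv ?_
    simp only [zero_mul, add_zero]
    field_simp
  have hcurve : HasDerivAt (fun s : ℝ => (m * (m + s * x k)⁻¹) • (p + s • e))
      (e - (x k / m) • p) 0 := by
    refine (hscale.fun_smul hline).congr_deriv ?_
    simp [hm.ne', sub_eq_add_neg]
  have hcomp : HasDerivAt (fun s : ℝ => v ((m * (m + s * x k)⁻¹) • (p + s • e)) m)
      (gp k - x k / m * ∑ j, gp j * p j) 0 := by
    have h := HasFDerivAt.comp_hasDerivAt
      (f := fun s : ℝ => (m * (m + s * x k)⁻¹) • (p + s • e)) 0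
      (by simpa [hm.ne'] using hgp) hcurve
    refine h.congr_deriv ?_
    simp [he, Pi.single_apply, mul_sub, Finset.sum_sub_distrib, Finset.mul_sum, mul_left_comm]
  have hpos : ∀ᶠ s : ℝ in nhds 0, posVec (p + s • e) := by
    refine Filter.eventually_all.2 fun j => ?_
    have h : ContinuousAt (fun s : ℝ => (p + s • e) j) 0 := by
      simp only [Pi.add_apply, Pi.smul_apply, smul_eq_mul]
      fun_prop
    exact h.eventually_const_lt (by simpa using hp j)
  have hmin : IsLocalMin (fun s : ℝ => v ((m * (m + s * x k)⁻¹) • (p + s • e)) m) 0 := by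
    filter_upwards [hpos, hexp.continuousAt.eventually_const_lt (by simpa using hm)]
      with s hs hc
    have hdot : dot (p + s • e) x = m + s * x k := by
      rw [← hpx]
      simp [dot, he, add_mul, Finset.sum_add_distrib, Pi.single_apply]
    have h := hv.smul_mul hs hc.le (mul_pos hm (inv_pos.2 hc))
    rw [inv_mul_cancel_right₀ hc.ne'] at h
    simp only [zero_mul, add_zero, mul_inv_cancel₀ hm.ne', one_smul, zero_smul]
    rw [h, ← hux]
    exact (hv _ _ hs hc.le).2 ⟨x, hx, hdot.le, rfl⟩
  have hzero := hmin.hasDerivAt_eq_zero hcomp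
  rw [heuler] at hzero
  field_simp at hzero
  linarith

/-- Walras' law with positive prices: a feasible allocation costing as much as the endowment
exhausts it. -/
theorem Feasible.sum_eq_of_cost_eq {K N : ℕ} {w p : Fin K → ℝ} {x : Fin N → Fin K → ℝ}
    (hx : Feasible w x) (hp : posVec p) (hcost : ∑ i, dot p (x i) = dot p w) (k : Fin K) :
    ∑ i, x i k = w k := by
  have h : ∑ j, p j * ∑ i, x i j = ∑ j, p j * w j := by
    simp only [dot] at hcost
    rw [← hcost, Finset.sum_comm]
    simp only [Finset.mul_sum]
  have hk := (Finset.sum_eq_sum_iff_of_le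
    fun j _ => mul_le_mul_of_nonneg_left (hx.2 j) (hp j).le).1 h k (Finset.mem_univ k)
  exact mul_left_cancel₀ (hp k).ne' hk

/-- dual Negishi first-order condition: at a Walrasian equilibrium with
positive incomes, markets clear and, with welfare weights equal to inverse marginal
utilities of income, the price satisfies `w + Σ_i α_i ∇_p v_i(p,m_i) = 0`. -/
theorem dual_negishi_first_order_condition {K N : ℕ} (hK : 1 ≤ K) (hN : 1 ≤ N)
    (w : Fin K → ℝ) (hw : posVec w)
    (u : Fin N → (Fin K → ℝ) → ℝ)
    (hu_cont : ∀ i, ContinuousOn (u i) {x | nonneg x})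
    (hu_mono : ∀ i x y, nonneg x → nonneg y → (∀ k, x k ≤ y k) → x ≠ y → u i x < u i y)
    (hu_qc : ∀ i (c : ℝ), Convex ℝ {x | nonneg x ∧ c ≤ u i x})
    (hu_diff : ∀ i, DifferentiableOn ℝ (u i) {x | posVec x})
    (v : Fin N → (Fin K → ℝ) → ℝ → ℝ)
    (hv : ∀ i, IsIndirectUtility (u i) (v i))
    (x : Fin N → Fin K → ℝ) (p : Fin K → ℝ) (m : Fin N → ℝ)
    (hm : IncomeSimplex m) (hm_pos : ∀ i, 0 < m i)
    (hWE : WalrasEq w u v x p m)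
    -- the price-gradient `∇_p v_i (p, m_i)` of each indirect utility
    (gp : Fin N → Fin K → ℝ)
    (hgp : ∀ i, HasFDerivAt (fun q : Fin K → ℝ => v i q (m i))
      (∑ k, gp i k • (ContinuousLinearMap.proj k : (Fin K → ℝ) →L[ℝ] ℝ)) p)
    -- the marginal utility of income `∂v_i/∂m (p, m_i)`
    (gm : Fin N → ℝ)
    (hgm : ∀ i, HasDerivAt (fun t : ℝ => v i p t) (gm i) (m i))
    (hgm_pos : ∀ i, 0 < gm i) :
    (∀ k, (∑ i, x i k) = w k) ∧
    (∀ k, w k + ∑ i, (gm i)⁻¹ * gp i k = 0) := by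
  obtain ⟨hx, ⟨hp, hpw⟩, heq⟩ := hWE
  have hclear : ∀ k, ∑ i, x i k = w k :=
    hx.sum_eq_of_cost_eq hp (by simp only [(heq _).1, hm.2, hpw])
  refine ⟨hclear, fun k => ?_⟩
  have hterm : ∀ i, (gm i)⁻¹ * gp i k = -x i k := fun i => by
    rw [(hv i).roy hp (hm_pos i) (hx.1 i) (heq i).1 (heq i).2 (hgp i) (hgm i) k,
      mul_neg, inv_mul_cancel_left₀ (hgm_pos i).ne']
  simp only [hterm, Finset.sum_neg_distrib, hclear, add_neg_cancel]
end
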